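/- Let y = y(t) = (1/2)(t/(2π))^{3/2} and define I₂ = ∑_{k=1}^{∞} d₃(k) k^{−1/2} ∫_T^{2T} ρ(k/y(t)) k^{it} χ(1/2+it)² dt. Then for large T, I₂ ≪ T^{3/4} log² T. -/

import Mathlib

open Complex Filter Real MeasureTheory Finset

noncomputable def chi (s : ℂ) : ℂ :=
  2 ^ s * (π : ℂ) ^ (s - 1) * Complex.sin (π * s / 2) * Complex.Gamma (1 - s)

noncomputable def Z (t : ℝ) : ℂ :=
  chi (1 / 2 + I * t) ^ (-(1 / 2 : ℂ)) * riemannZeta (1 / 2 + I * t)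

/-- number of positive divisors -/
noncomputable def d (k : ℕ) : ℕ := k.divisors.card

/-- number of ordered triples of positive integers with product `n` -/
noncomputable def d3 (n : ℕ) : ℕ :=
  ((Finset.Icc 1 n ×ˢ Finset.Icc 1 n ×ˢ Finset.Icc 1 n).filter
    fun p : ℕ × ℕ × ℕ => p.1 * p.2.1 * p.2.2 = n).card

/-- sum over integers `a ≤ k ≤ b` where terms at integer endpoints are halved -/
noncomputable def psum (a b : ℝ) (f : ℕ → ℂ) : ℂ :=
  ∑ k ∈ Finset.Icc ⌈a⌉₊ ⌊b⌋₊,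
    (if (k : ℝ) = a ∨ (k : ℝ) = b then (1 / 2 : ℂ) else 1) * f k

/-- First derivative test for a decreasing phase derivative `φ ≤ -1`. -/
theorem norm_integral_mul_exp_le {A B M : ℝ} (hAB : A ≤ B) {w w' θ φ φ' : ℝ → ℝ}
    (hw : ∀ t ∈ Set.Icc A B, HasDerivAt w (w' t) t) (hw'c : ContinuousOn w' (Set.Icc A B))
    (hθ : ∀ t ∈ Set.Icc A B, HasDerivAt θ (φ t) t)
    (hφ : ∀ t ∈ Set.Icc A B, HasDerivAt φ (φ' t) t) (hφ'c : ContinuousOn φ' (Set.Icc A B))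
    (hφ' : ∀ t ∈ Set.Icc A B, φ' t ≤ 0) (hφ1 : ∀ t ∈ Set.Icc A B, φ t ≤ -1)
    (hw1 : ∀ t ∈ Set.Icc A B, |w t| ≤ 1) (hw'M : ∀ t ∈ Set.Icc A B, |w' t| ≤ M) :
    ‖∫ t in A..B, (w t : ℂ) * cexp (I * θ t)‖ ≤ 3 + M * (B - A) := by
  have hI : Set.uIcc A B = Set.Icc A B := Set.uIcc_of_le hAB
  have hφ0 : ∀ t ∈ Set.Icc A B, φ t ≠ 0 := fun t ht => by linarith [hφ1 t ht]
  have hwc : ContinuousOn w (Set.Icc A B) := fun t ht => (hw t ht).continuousAt.continuousWithinAt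
  have hθc : ContinuousOn θ (Set.Icc A B) := fun t ht => (hθ t ht).continuousAt.continuousWithinAt
  have hφc : ContinuousOn φ (Set.Icc A B) := fun t ht => (hφ t ht).continuousAt.continuousWithinAt
  set q' : ℝ → ℝ := fun t => (w' t * φ t - w t * φ' t) / φ t ^ 2 with hq'
  have hq : ∀ t ∈ Set.Icc A B, HasDerivAt (fun t => w t / φ t) (q' t) t := fun t ht =>
    (hw t ht).div (hφ t ht) (hφ0 t ht)
  have hq'c : ContinuousOn q' (Set.Icc A B) :=
    ((hw'c.mul hφc).sub (hwc.mul hφ'c)).div (hφc.pow 2) fun t ht => pow_ne_zero 2 (hφ0 t ht)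
  have he : ∀ t ∈ Set.Icc A B,
      HasDerivAt (fun t => -I * cexp (I * θ t)) (φ t * cexp (I * θ t)) t := fun t ht => by
    have := (((hθ t ht).ofReal_comp).const_mul I).cexp.const_mul (-I)
    exact this.congr_deriv (by linear_combination (-(φ t : ℂ) * cexp (I * θ t)) * I_sq)
  have hec : ContinuousOn (fun t => cexp (I * θ t)) (Set.Icc A B) := by fun_prop
  have hnorm : ∀ x : ℝ, ‖cexp (I * x)‖ = 1 := fun x => by
    rw [mul_comm]; exact norm_exp_ofReal_mul_I x
  have hparts := intervalIntegral.integral_mul_deriv_eq_deriv_mul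
    (u := fun t => ((w t / φ t : ℝ) : ℂ)) (u' := fun t => ((q' t : ℝ) : ℂ))
    (v := fun t => -I * cexp (I * θ t)) (v' := fun t => φ t * cexp (I * θ t)) (a := A) (b := B)
    (fun t ht => (hq t (hI ▸ ht)).ofReal_comp) (fun t ht => he t (hI ▸ ht))
    (ContinuousOn.intervalIntegrable (by rw [hI]; fun_prop))
    (ContinuousOn.intervalIntegrable (by rw [hI]; fun_prop))
  have hcongr : ∫ t in A..B, (w t : ℂ) * cexp (I * θ t) =
      ∫ t in A..B, ((w t / φ t : ℝ) : ℂ) * (φ t * cexp (I * θ t)) := by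
    refine intervalIntegral.integral_congr fun t ht => ?_
    have : (φ t : ℂ) ≠ 0 := by exact_mod_cast hφ0 t (hI ▸ ht)
    push_cast
    field_simp
  have hwφ : ∀ t ∈ Set.Icc A B, |w t / φ t| ≤ -(φ t)⁻¹ := fun t ht => by
    have h1 := hφ1 t ht
    rw [abs_div, abs_of_neg (by linarith : φ t < 0), ← inv_neg, ← one_div]
    exact div_le_div_of_nonneg_right (hw1 t ht) (by linarith)
  have hinv : ∀ t ∈ Set.Icc A B, -(φ t)⁻¹ ≤ 1 := fun t ht => by
    rw [← inv_neg]; exact inv_le_one_of_one_le₀ (by linarith [hφ1 t ht])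
  have hbd : ∀ t ∈ Set.Icc A B, |q' t| ≤ M + -φ' t / φ t ^ 2 := fun t ht => by
    have h1 := hφ1 t ht
    have h2 : q' t = w' t / φ t - w t * φ' t / φ t ^ 2 := by
      have := hφ0 t ht
      simp only [hq']; field_simp
    have hp : 0 < φ t ^ 2 := by nlinarith
    rw [h2]
    refine (abs_sub _ _).trans (add_le_add ?_ ?_)
    · rw [abs_div]
      exact (div_le_self (abs_nonneg _) (by rw [le_abs]; right; linarith)).trans (hw'M t ht)
    · rw [abs_div, abs_of_pos hp, abs_mul, abs_of_nonpos (hφ' t ht)]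
      gcongr
      nlinarith [hw1 t ht, hφ' t ht]
  have hint : ∫ t in A..B, (M + -φ' t / φ t ^ 2) = M * (B - A) + ((φ B)⁻¹ - (φ A)⁻¹) := by
    have hc : ContinuousOn (fun t => -φ' t / φ t ^ 2) (Set.Icc A B) :=
      hφ'c.neg.div (hφc.pow 2) fun t ht => pow_ne_zero 2 (hφ0 t ht)
    rw [intervalIntegral.integral_add intervalIntegrable_const
      (ContinuousOn.intervalIntegrable (by rwa [hI])), intervalIntegral.integral_const,
      intervalIntegral.integral_eq_sub_of_hasDerivAt (f := fun t => (φ t)⁻¹)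
        (fun t ht => (hφ t (hI ▸ ht)).inv (hφ0 t (hI ▸ ht)))
        (ContinuousOn.intervalIntegrable (by rwa [hI]))]
    simp [mul_comm]
  have hlast : ‖∫ t in A..B, ((q' t : ℝ) : ℂ) * (-I * cexp (I * θ t))‖ ≤
      M * (B - A) + ((φ B)⁻¹ - (φ A)⁻¹) := by
    rw [← hint]
    refine intervalIntegral.norm_integral_le_of_norm_le hAB (Eventually.of_forall fun t ht => ?_) ?_
    · rw [norm_mul, norm_mul, norm_neg, norm_I, one_mul, hnorm, mul_one, Complex.norm_real]
      exact hbd t (Set.Ioc_subset_Icc_self ht)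
    · refine ContinuousOn.intervalIntegrable ?_
      rw [hI]
      exact continuousOn_const.add
        (hφ'c.neg.div (hφc.pow 2) fun t ht => pow_ne_zero 2 (hφ0 t ht))
  have hend : ∀ t ∈ Set.Icc A B,
      ‖((w t / φ t : ℝ) : ℂ) * (-I * cexp (I * θ t))‖ ≤ -(φ t)⁻¹ := fun t ht => by
    rw [norm_mul, norm_mul, norm_neg, norm_I, one_mul, hnorm, mul_one, Complex.norm_real]
    exact hwφ t ht
  have hA := Set.left_mem_Icc.2 hAB
  have hB := Set.right_mem_Icc.2 hAB
  rw [hcongr, hparts]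
  have := norm_sub_le (((w B / φ B : ℝ) : ℂ) * (-I * cexp (I * θ B)) -
    ((w A / φ A : ℝ) : ℂ) * (-I * cexp (I * θ A)))
    (∫ t in A..B, ((q' t : ℝ) : ℂ) * (-I * cexp (I * θ t)))
  have h3 := norm_sub_le (((w B / φ B : ℝ) : ℂ) * (-I * cexp (I * θ B)))
    (((w A / φ A : ℝ) : ℂ) * (-I * cexp (I * θ A)))
  linarith [hend A hA, hend B hB, hinv A hA, hinv B hB]

theorem chi_eq_Gammaℝ_div {s : ℂ} (hs1 : s.re < 1) :
    chi s = Gammaℝ (1 - s) / Gammaℝ s := by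
  have h := inv_Gammaℝ_one_sub (s := 1 - s) (fun n hn => by
    have := congrArg re hn
    simp at this
    have h0 : (0 : ℝ) ≤ n := n.cast_nonneg
    linarith)
  have h1 : Gammaℝ (1 - s) ≠ 0 := Gammaℝ_ne_zero_of_re_pos (by simpa using hs1)
  rw [sub_sub_cancel, Gammaℂ_def] at h
  have h2 : cos (π * (1 - s) / 2) = sin (π * s / 2) := by
    rw [show (π : ℂ) * (1 - s) / 2 = π / 2 - π * s / 2 by ring, Complex.cos_pi_div_two_sub]
  have h3 : (2 * π : ℂ) ^ (-(1 - s)) = 2 ^ (s - 1) * (π : ℂ) ^ (s - 1) := by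
    rw [neg_sub]
    exact_mod_cast mul_cpow_ofReal_nonneg (a := 2) (b := π) (by norm_num) pi_pos.le (s - 1)
  have h4 : (2 : ℂ) ^ s = 2 * 2 ^ (s - 1) := by
    rw [cpow_sub _ _ two_ne_zero, cpow_one]; ring
  rw [div_eq_mul_inv, h, h2, h3, chi, h4]
  field_simp

theorem chi_critical_line (t : ℝ) : chi (1 / 2 + I * t) =
    (π : ℂ) ^ (I * t) * (Gamma (1 / 4 - I * (t / 2)) / Gamma (1 / 4 + I * (t / 2))) := by
  rw [chi_eq_Gammaℝ_div (by simp; norm_num), Gammaℝ_def, Gammaℝ_def, mul_div_mul_comm,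
    ← cpow_sub _ _ (by exact_mod_cast pi_ne_zero)]
  ring_nf

/-- `log (c + i x) - log (c - i x) = 2 i arctan (x / c)`, exponentiated. -/
theorem add_I_div_sub_I_eq_exp {c : ℝ} (hc : 0 < c) (x : ℝ) :
    ((c : ℂ) + I * x) / (c - I * x) = cexp (I * (2 * Real.arctan (x / c) : ℝ)) := by
  have hpos : (0 : ℝ) < 1 + (x / c) ^ 2 := by positivity
  have hsq : ((√(1 + (x / c) ^ 2) : ℝ) : ℂ) ^ 2 = 1 + (x / c) ^ 2 := by
    exact_mod_cast Real.sq_sqrt hpos.le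
  have hs0 : ((√(1 + (x / c) ^ 2) : ℝ) : ℂ) ≠ 0 := by
    exact_mod_cast (Real.sqrt_pos.2 hpos).ne'
  have hc0 : (c : ℂ) ≠ 0 := by exact_mod_cast hc.ne'
  have hd : (c : ℂ) - I * x ≠ 0 := fun h => by
    have := congrArg re h; simp at this; linarith
  have he : cexp (I * (Real.arctan (x / c) : ℝ)) =
      (1 + I * (x / c)) / (√(1 + (x / c) ^ 2) : ℝ) := by
    rw [mul_comm, exp_mul_I, ← ofReal_cos, ← ofReal_sin, Real.cos_arctan, Real.sin_arctan]
    push_cast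
    field_simp
  have h2 : cexp (I * (2 * Real.arctan (x / c) : ℝ)) = cexp (I * (Real.arctan (x / c) : ℝ)) ^ 2 := by
    rw [← Complex.exp_nat_mul]; push_cast; ring_nf
  have hq : (1 : ℂ) + (x / c) ^ 2 ≠ 0 := by exact_mod_cast hpos.ne'
  rw [h2, he, div_pow, hsq, div_eq_div_iff hd hq]
  field_simp
  linear_combination (c * x ^ 2 + I * x ^ 3 : ℂ) * I_sq

/-- Phase of the square of the `N`-th Euler approximation of `Γ(1/4 - it/2) / Γ(1/4 + it/2)`,
twisted by `exp (i L t)`. -/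
noncomputable def gammaPhase (L : ℝ) (N : ℕ) (t : ℝ) : ℝ :=
  (L - 2 * Real.log N) * t + ∑ j ∈ range (N + 1), 4 * Real.arctan (t / 2 / (j + 1 / 4))

theorem exp_gammaPhase (L : ℝ) {N : ℕ} (hN : N ≠ 0) (t : ℝ) :
    cexp (I * gammaPhase L N t) = cexp (I * (L * t)) *
      (GammaSeq (1 / 4 - I * (t / 2)) N / GammaSeq (1 / 4 + I * (t / 2)) N) ^ 2 := by
  have hN' : (N : ℂ) ≠ 0 := by exact_mod_cast hN
  have hNf : ((N.factorial : ℕ) : ℂ) ≠ 0 := by exact_mod_cast N.factorial_ne_zero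
  have hprod : GammaSeq (1 / 4 - I * (t / 2)) N / GammaSeq (1 / 4 + I * (t / 2)) N =
      (N : ℂ) ^ (-(I * t)) *
      ∏ j ∈ range (N + 1), ((((j + 1 / 4 : ℝ) : ℂ) + I * (t / 2 : ℝ)) /
        (((j + 1 / 4 : ℝ) : ℂ) - I * (t / 2 : ℝ))) := by
    have hpow : (N : ℂ) ^ (-(I * t)) =
        (N : ℂ) ^ (1 / 4 - I * ((t : ℂ) / 2)) / (N : ℂ) ^ (1 / 4 + I * ((t : ℂ) / 2)) := by
      rw [← cpow_sub _ _ hN']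
      ring_nf
    rw [Complex.GammaSeq, Complex.GammaSeq, hpow, prod_div_distrib]
    have hNp : (N : ℂ) ^ (1 / 4 + I * ((t : ℂ) / 2)) ≠ 0 := by simp [cpow_eq_zero_iff, hN]
    have e1 : ∏ j ∈ range (N + 1), ((1 / 4 - I * ((t : ℂ) / 2)) + j) =
        ∏ j ∈ range (N + 1), (((j + 1 / 4 : ℝ) : ℂ) - I * (t / 2 : ℝ)) :=
      prod_congr rfl fun j _ => by push_cast; ring
    have e2 : ∏ j ∈ range (N + 1), ((1 / 4 + I * ((t : ℂ) / 2)) + j) =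
        ∏ j ∈ range (N + 1), (((j + 1 / 4 : ℝ) : ℂ) + I * (t / 2 : ℝ)) :=
      prod_congr rfl fun j _ => by push_cast; ring
    rw [e1, e2]
    generalize (N : ℂ) ^ (1 / 4 + I * ((t : ℂ) / 2)) = u at hNp ⊢
    generalize (N : ℂ) ^ (1 / 4 - I * ((t : ℂ) / 2)) = v
    generalize ∏ j ∈ range (N + 1), (((j + 1 / 4 : ℝ) : ℂ) - I * (t / 2 : ℝ)) = P
    generalize ∏ j ∈ range (N + 1), (((j + 1 / 4 : ℝ) : ℂ) + I * (t / 2 : ℝ)) = Q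
    field_simp
  have hNt : (N : ℂ) ^ (-(I * t)) = cexp (I * (-(Real.log N) * t : ℝ)) := by
    rw [cpow_def_of_ne_zero hN']
    push_cast; ring_nf
  rw [hprod, hNt, prod_congr rfl fun j _ => add_I_div_sub_I_eq_exp (by positivity) _,
    ← Complex.exp_sum, ← Complex.exp_add, ← Complex.exp_nat_mul, ← Complex.exp_add, gammaPhase]
  congr 1
  push_cast
  simp only [← mul_sum]
  ring

theorem tendsto_exp_gammaPhase (L t : ℝ) :
    Tendsto (fun N => cexp (I * gammaPhase L N t)) atTop (nhds (cexp (I * (L * t)) *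
      (Gamma (1 / 4 - I * (t / 2)) / Gamma (1 / 4 + I * (t / 2))) ^ 2)) := by
  have h0 : Gamma (1 / 4 + I * (t / 2)) ≠ 0 := Gamma_ne_zero_of_re_pos (by simp)
  refine Tendsto.congr' ?_ ((((GammaSeq_tendsto_Gamma (1 / 4 - I * (t / 2))).div
    (GammaSeq_tendsto_Gamma (1 / 4 + I * (t / 2))) h0).pow 2).const_mul (cexp (I * (L * t))))
  filter_upwards [eventually_ne_atTop 0] with N hN
  exact (exp_gammaPhase L hN t).symm

/-- The first derivative of `gammaPhase`. -/
noncomputable def gammaPhaseDeriv (L : ℝ) (N : ℕ) (t : ℝ) : ℝ :=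
  (L - 2 * Real.log N) +
    ∑ j ∈ range (N + 1), 2 * ((j + 1 / 4 : ℝ) / ((j + 1 / 4 : ℝ) ^ 2 + (t / 2) ^ 2))

/-- The second derivative of `gammaPhase`. -/
noncomputable def gammaPhaseDeriv₂ (N : ℕ) (t : ℝ) : ℝ :=
  ∑ j ∈ range (N + 1),
    -((j + 1 / 4 : ℝ) * t / ((j + 1 / 4 : ℝ) ^ 2 + (t / 2) ^ 2) ^ 2)

theorem hasDerivAt_gammaPhase (L : ℝ) (N : ℕ) (t : ℝ) :
    HasDerivAt (gammaPhase L N) (gammaPhaseDeriv L N t) t := by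
  refine HasDerivAt.add (by simpa using (hasDerivAt_id t).const_mul (L - 2 * Real.log N)) ?_
  refine HasDerivAt.fun_sum fun j _ => ?_
  have hc : (0 : ℝ) < j + 1 / 4 := by positivity
  refine (((((hasDerivAt_id t).div_const 2).div_const (j + 1 / 4 : ℝ)).arctan).const_mul 4).congr_deriv ?_
  simp only [id]
  generalize (j + 1 / 4 : ℝ) = c at hc
  have h1 : c ^ 2 + (t / 2) ^ 2 ≠ 0 := by positivity
  have h2 : 1 + (t / 2 / c) ^ 2 ≠ 0 := by positivity
  field_simp
  ring

theorem hasDerivAt_gammaPhaseDeriv (L : ℝ) (N : ℕ) (t : ℝ) :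
    HasDerivAt (gammaPhaseDeriv L N) (gammaPhaseDeriv₂ N t) t := by
  refine HasDerivAt.const_add _ (HasDerivAt.fun_sum fun j _ => ?_)
  have hc : (0 : ℝ) < j + 1 / 4 := by positivity
  generalize (j + 1 / 4 : ℝ) = c at hc
  have h1 : c ^ 2 + (t / 2) ^ 2 ≠ 0 := by positivity
  refine (((hasDerivAt_const t c).div
    ((((hasDerivAt_id t).div_const 2).pow 2).const_add (c ^ 2)) h1).const_mul 2).congr_deriv ?_
  simp only [id, Pi.pow_apply]
  field_simp
  ring

theorem continuous_gammaPhaseDeriv₂ (N : ℕ) : Continuous (gammaPhaseDeriv₂ N) := by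
  refine continuous_finsetSum _ fun j _ => ?_
  have hc : (0 : ℝ) < j + 1 / 4 := by positivity
  exact ((continuous_const.mul continuous_id).div (by fun_prop) fun t => by positivity).neg

theorem gammaPhaseDeriv₂_nonpos (N : ℕ) {t : ℝ} (ht : 0 ≤ t) : gammaPhaseDeriv₂ N t ≤ 0 :=
  sum_nonpos fun j _ => neg_nonpos.2 (by positivity)

theorem sum_div_sq_add_sq_le (N : ℕ) {b : ℝ} (hb : 0 < b) :
    ∑ j ∈ range (N + 1), (j + 1 / 4 : ℝ) / ((j + 1 / 4 : ℝ) ^ 2 + b ^ 2) ≤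
      Real.log ((N + 1 / 4 : ℝ) ^ 2 + b ^ 2) / 2 - Real.log b + 5 - 1 / (N + 1) := by
  induction N with
  | zero =>
    have h1 : Real.log (b ^ 2) ≤ Real.log ((1 / 4 : ℝ) ^ 2 + b ^ 2) :=
      Real.log_le_log (by positivity) (by norm_num)
    rw [Real.log_pow] at h1
    have h2 : (1 / 4 : ℝ) / ((1 / 4 : ℝ) ^ 2 + b ^ 2) ≤ 4 := by
      rw [div_le_iff₀ (by positivity)]; nlinarith [sq_nonneg b]
    simp only [zero_add, range_one, sum_singleton, Nat.cast_zero]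
    push_cast at h1
    linarith
  | succ N ih =>
    rw [sum_range_succ]
    push_cast
    set x : ℝ := N + 1 + 1 / 4 with hx
    have hN : (0 : ℝ) ≤ N := N.cast_nonneg
    have hX : 0 < x ^ 2 + b ^ 2 := by positivity
    have hY : 0 < (N + 1 / 4 : ℝ) ^ 2 + b ^ 2 := by positivity
    have hlog := Real.log_le_sub_one_of_pos (div_pos hY hX)
    rw [Real.log_div hY.ne' hX.ne'] at hlog
    have h1 : ((N + 1 / 4 : ℝ) ^ 2 + b ^ 2) / (x ^ 2 + b ^ 2) - 1 =
        -2 * (x / (x ^ 2 + b ^ 2)) + 1 / (x ^ 2 + b ^ 2) := by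
      field_simp
      rw [hx]; ring
    have h2 : 1 / (x ^ 2 + b ^ 2) ≤ 2 * (1 / (N + 1 : ℝ) - 1 / (N + 1 + 1)) := by
      rw [show 2 * (1 / (N + 1 : ℝ) - 1 / (N + 1 + 1)) = 2 / ((N + 1) * (N + 1 + 1)) by
        field_simp; ring, div_le_div_iff₀ hX (by positivity)]
      nlinarith [sq_nonneg b]
    linarith

theorem gammaPhaseDeriv_le (L : ℝ) {N : ℕ} {t : ℝ} (ht : 0 < t) (hN1 : 1 ≤ N) (hN : t ≤ N) :
    gammaPhaseDeriv L N t ≤ L - 2 * Real.log t + 14 := by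
  have h := sum_div_sq_add_sq_le N (b := t / 2) (by positivity)
  have hN1' : (1 : ℝ) ≤ N := by exact_mod_cast hN1
  have h1 : Real.log ((N + 1 / 4 : ℝ) ^ 2 + (t / 2) ^ 2) ≤ Real.log (2 * N ^ 2) :=
    Real.log_le_log (by positivity) (by nlinarith)
  rw [Real.log_mul (by norm_num) (by positivity), Real.log_pow] at h1
  rw [Real.log_div ht.ne' (by norm_num)] at h
  have h3 : 0 ≤ 1 / ((N : ℝ) + 1) := by positivity
  rw [gammaPhaseDeriv, ← mul_sum]
  push_cast at h1
  linarith [Real.log_two_lt_d9]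

theorem cutoff_eq_one {ρ : ℝ → ℝ}
    (hρ_fe : ∀ u : ℝ, 0 < u → ρ u + ρ (1 / u) = 1) (hρ_supp : ∀ u : ℝ, 2 ≤ u → ρ u = 0)
    {u : ℝ} (hu : 0 < u) (hu2 : u ≤ 1 / 2) : ρ u = 1 := by
  have := hρ_supp (1 / u) (by rw [le_div_iff₀ hu]; linarith)
  linarith [hρ_fe u hu]

theorem exists_abs_mul_deriv_le {ρ : ℝ → ℝ} (hρ_smooth : ContDiffOn ℝ (⊤ : ℕ∞) ρ (Set.Ioi 0))
    (hρ_fe : ∀ u : ℝ, 0 < u → ρ u + ρ (1 / u) = 1) (hρ_supp : ∀ u : ℝ, 2 ≤ u → ρ u = 0) :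
    ∃ M : ℝ, 0 ≤ M ∧ ∀ u : ℝ, 0 < u → |u * deriv ρ u| ≤ M := by
  have hc : ContinuousOn (deriv ρ) (Set.Ioi 0) :=
    hρ_smooth.continuousOn_deriv_of_isOpen isOpen_Ioi (by exact_mod_cast le_top)
  obtain ⟨M, hM⟩ := (isCompact_Icc (a := (1 / 2 : ℝ)) (b := 2)).exists_bound_of_continuousOn
    (continuousOn_id.mul (hc.mono fun u hu => lt_of_lt_of_le (by norm_num) hu.1))
  have hM0 : 0 ≤ M := (norm_nonneg _).trans (hM 1 (by norm_num))
  refine ⟨M, hM0, fun u hu => ?_⟩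
  rcases lt_or_ge u (1 / 2) with h | h
  · have : deriv ρ u = 0 := by
      have : ρ =ᶠ[nhds u] fun _ => 1 := by
        filter_upwards [Ioo_mem_nhds hu h] with v hv
        exact cutoff_eq_one hρ_fe hρ_supp hv.1 hv.2.le
      rw [this.deriv_eq, deriv_const]
    simpa [this] using hM0
  rcases lt_or_ge 2 u with h' | h'
  · have : deriv ρ u = 0 := by
      have : ρ =ᶠ[nhds u] fun _ => 0 := by
        filter_upwards [Ioi_mem_nhds h'] with v hv
        exact hρ_supp v (le_of_lt hv)
      rw [this.deriv_eq, deriv_const]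
    simpa [this] using hM0
  · exact hM u ⟨h, h'⟩

theorem abs_cutoff_le_one {ρ : ℝ → ℝ} (hρ_nonneg : ∀ u : ℝ, 0 < u → 0 ≤ ρ u)
    (hρ_fe : ∀ u : ℝ, 0 < u → ρ u + ρ (1 / u) = 1) {u : ℝ} (hu : 0 < u) : |ρ u| ≤ 1 := by
  rw [abs_of_nonneg (hρ_nonneg u hu)]
  linarith [hρ_fe u hu, hρ_nonneg (1 / u) (by positivity)]

theorem sum_rpow_neg_half_le {x : ℝ} (hx : 0 ≤ x) :
    ∑ c ∈ Icc 1 ⌊x⌋₊, (c : ℝ) ^ (-(1 : ℝ) / 2) ≤ 2 * x ^ ((1 : ℝ) / 2) := by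
  have key : ∀ n : ℕ, ∑ c ∈ Icc 1 n, (c : ℝ) ^ (-(1 : ℝ) / 2) ≤ 2 * √n := by
    intro n
    induction n with
    | zero => simp
    | succ n ih =>
      rw [sum_Icc_succ_top (by omega)]
      have h1 : ((n + 1 : ℕ) : ℝ) ^ (-(1 : ℝ) / 2) = 1 / √((n + 1 : ℕ) : ℝ) := by
        rw [neg_div, Real.rpow_neg (by positivity), Real.sqrt_eq_rpow, one_div, one_div]
      have h2 : 0 < √((n + 1 : ℕ) : ℝ) := Real.sqrt_pos.2 (by positivity)
      have h3 := Real.sq_sqrt (by positivity : (0 : ℝ) ≤ ((n + 1 : ℕ) : ℝ))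
      have h4 := Real.sq_sqrt (by positivity : (0 : ℝ) ≤ (n : ℝ))
      rw [h1]
      have h5 : 1 / √((n + 1 : ℕ) : ℝ) ≤ 2 * √((n + 1 : ℕ) : ℝ) - 2 * √(n : ℝ) := by
        rw [div_le_iff₀ h2]
        push_cast at *
        nlinarith [sq_nonneg (√((n : ℝ) + 1) - √(n : ℝ))]
      linarith
  refine (key _).trans ?_
  rw [← Real.sqrt_eq_rpow]
  gcongr
  exact Nat.floor_le hx

theorem sum_inv_le_one_add_log (n : ℕ) : ∑ a ∈ Icc 1 n, (a : ℝ)⁻¹ ≤ 1 + Real.log n := by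
  have := harmonic_le_one_add_log n
  rw [harmonic_eq_sum_Icc] at this
  push_cast at this
  exact this

theorem d3_zero : d3 0 = 0 := by simp [d3]

theorem sum_d3_le (f : ℕ → ℝ) (hf : ∀ n, 0 ≤ f n) (n : ℕ) :
    ∑ k ∈ range (n + 1), (d3 k : ℝ) * f k ≤
      ∑ a ∈ Icc 1 n, ∑ b ∈ Icc 1 n, ∑ c ∈ Icc 1 (n / (a * b)), f (a * b * c) := by
  set S : Finset (Σ _ : ℕ, ℕ × ℕ × ℕ) := (range (n + 1)).sigma fun k =>
    (Icc 1 k ×ˢ Icc 1 k ×ˢ Icc 1 k).filter fun p : ℕ × ℕ × ℕ => p.1 * p.2.1 * p.2.2 = k with hS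
  have h1 : ∑ k ∈ range (n + 1), (d3 k : ℝ) * f k = ∑ p ∈ S, f p.1 := by
    rw [hS, sum_sigma]
    refine sum_congr rfl fun k _ => ?_
    simp [d3]
  set R : Finset (Σ _ : ℕ, Σ _ : ℕ, ℕ) :=
    (Icc 1 n).sigma fun a => (Icc 1 n).sigma fun b => Icc 1 (n / (a * b)) with hR
  have h2 : ∑ a ∈ Icc 1 n, ∑ b ∈ Icc 1 n, ∑ c ∈ Icc 1 (n / (a * b)), f (a * b * c) =
      ∑ q ∈ R, f (q.1 * q.2.1 * q.2.2) := by
    rw [hR, sum_sigma]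
    refine sum_congr rfl fun a _ => ?_
    rw [sum_sigma]
  rw [h1, h2]
  set g : (Σ _ : ℕ, ℕ × ℕ × ℕ) → (Σ _ : ℕ, Σ _ : ℕ, ℕ) := fun p => ⟨p.2.1, p.2.2.1, p.2.2.2⟩
    with hg
  have hprod : ∀ p ∈ S, p.2.1 * p.2.2.1 * p.2.2.2 = p.1 := by
    rintro ⟨k, a, b, c⟩ hp
    simp only [hS, mem_sigma, mem_filter] at hp
    exact hp.2.2
  have hinj : Set.InjOn g S := by
    rintro ⟨k, a, b, c⟩ hp ⟨k', a', b', c'⟩ hp' h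
    have e := hprod _ hp
    have e' := hprod _ hp'
    simp only [hg, Sigma.mk.injEq, heq_eq_eq] at h e e'
    obtain ⟨rfl, rfl, rfl⟩ := h
    rw [← e, ← e']
  calc ∑ p ∈ S, f p.1 = ∑ q ∈ S.image g, f (q.1 * q.2.1 * q.2.2) := by
        rw [sum_image hinj]
        exact sum_congr rfl fun p hp => by rw [← hprod p hp]
    _ ≤ _ := by
        refine sum_le_sum_of_subset_of_nonneg ?_ fun _ _ _ => hf _
        rw [image_subset_iff]
        rintro ⟨k, a, b, c⟩ hp
        have e := hprod _ hp
        simp only [hS, hR, hg, mem_sigma, mem_filter, mem_product, mem_Icc, mem_range] at hp e ⊢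
        obtain ⟨hk, ⟨⟨ha, ha'⟩, ⟨hb, hb'⟩, hc, -⟩, -⟩ := hp
        refine ⟨⟨ha, by omega⟩, ⟨hb, by omega⟩, hc, ?_⟩
        rw [Nat.le_div_iff_mul_le (by positivity), mul_comm, e]
        omega

theorem sum_d3_rpow_le {x : ℝ} (hx : 1 ≤ x) :
    ∑ k ∈ range (⌊x⌋₊ + 1), (d3 k : ℝ) * (k : ℝ) ^ (-(1 : ℝ) / 2) ≤
      2 * x ^ ((1 : ℝ) / 2) * (1 + Real.log x) ^ 2 := by
  have hx0 : 0 < x := by linarith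
  refine (sum_d3_le _ (fun n => by positivity) _).trans ?_
  have hinner : ∀ a ∈ Icc 1 ⌊x⌋₊, ∀ b ∈ Icc 1 ⌊x⌋₊,
      ∑ c ∈ Icc 1 (⌊x⌋₊ / (a * b)), ((a * b * c : ℕ) : ℝ) ^ (-(1 : ℝ) / 2) ≤
        2 * x ^ ((1 : ℝ) / 2) * ((a : ℝ)⁻¹ * (b : ℝ)⁻¹) := by
    intro a ha b hb
    have ha0 : (0 : ℝ) < a := by exact_mod_cast (mem_Icc.1 ha).1
    have hb0 : (0 : ℝ) < b := by exact_mod_cast (mem_Icc.1 hb).1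
    have hm : (0 : ℝ) < a * b := by positivity
    have hfl : ⌊x⌋₊ / (a * b) = ⌊x / (a * b)⌋₊ := by
      rw [← Nat.floor_div_natCast]; push_cast; rfl
    have h := sum_rpow_neg_half_le (x := x / (a * b)) (by positivity)
    rw [hfl]
    calc _ = ((a : ℝ) * b) ^ (-(1 : ℝ) / 2) *
          ∑ c ∈ Icc 1 ⌊x / (a * b)⌋₊, (c : ℝ) ^ (-(1 : ℝ) / 2) := by
          rw [mul_sum]
          refine sum_congr rfl fun c _ => ?_
          push_cast
          rw [Real.mul_rpow hm.le (by positivity)]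
      _ ≤ ((a : ℝ) * b) ^ (-(1 : ℝ) / 2) * (2 * (x / (a * b)) ^ ((1 : ℝ) / 2)) := by gcongr
      _ = 2 * x ^ ((1 : ℝ) / 2) * ((a : ℝ)⁻¹ * (b : ℝ)⁻¹) := by
          rw [Real.div_rpow hx0.le hm.le, neg_div, Real.rpow_neg hm.le, ← Real.sqrt_eq_rpow (a * b : ℝ)]
          have := Real.sq_sqrt hm.le
          rw [← mul_inv, show ((a : ℝ) * b)⁻¹ = (√(a * b : ℝ))⁻¹ ^ 2 by rw [inv_pow, this]]
          ring
  have hlog : ∑ a ∈ Icc 1 ⌊x⌋₊, (a : ℝ)⁻¹ ≤ 1 + Real.log x :=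
    (sum_inv_le_one_add_log _).trans (by
      gcongr
      · exact_mod_cast Nat.floor_pos.2 hx
      · exact Nat.floor_le hx0.le)
  calc _ ≤ ∑ a ∈ Icc 1 ⌊x⌋₊, ∑ b ∈ Icc 1 ⌊x⌋₊,
        2 * x ^ ((1 : ℝ) / 2) * ((a : ℝ)⁻¹ * (b : ℝ)⁻¹) :=
        sum_le_sum fun a ha => sum_le_sum fun b hb => hinner a ha b hb
    _ = 2 * x ^ ((1 : ℝ) / 2) * (∑ a ∈ Icc 1 ⌊x⌋₊, (a : ℝ)⁻¹) ^ 2 := by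
        rw [sq, sum_mul_sum, mul_sum]
        simp_rw [mul_sum]
    _ ≤ _ := by
        gcongr

theorem hasDerivAt_cutoff {ρ : ℝ → ℝ} (hρ_smooth : ContDiffOn ℝ (⊤ : ℕ∞) ρ (Set.Ioi 0))
    {x t : ℝ} (hx : 0 < x) (ht : 0 < t) :
    HasDerivAt (fun t => ρ (x / ((1 / 2) * (t / (2 * π)) ^ ((3 : ℝ) / 2))))
      (deriv ρ (x / ((1 / 2) * (t / (2 * π)) ^ ((3 : ℝ) / 2))) *
        (-(3 / 2) * (x / ((1 / 2) * (t / (2 * π)) ^ ((3 : ℝ) / 2))) / t)) t := by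
  have hs : 0 < t / (2 * π) := by positivity
  have hy : 0 < (1 / 2) * (t / (2 * π)) ^ ((3 : ℝ) / 2) := by positivity
  have hdρ : HasDerivAt ρ (deriv ρ (x / ((1 / 2) * (t / (2 * π)) ^ ((3 : ℝ) / 2))))
      (x / ((1 / 2) * (t / (2 * π)) ^ ((3 : ℝ) / 2))) :=
    ((hρ_smooth.differentiableOn (by simp)).differentiableAt
      (Ioi_mem_nhds (div_pos hx hy))).hasDerivAt
  have hpow := ((((hasDerivAt_id t).div_const (2 * π)).rpow_const (p := (3 : ℝ) / 2)
    (Or.inl hs.ne')).const_mul (1 / 2 : ℝ))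
  have hdiv := (hasDerivAt_const t x).div hpow hy.ne'
  refine (hdρ.comp t hdiv).congr_deriv ?_
  congr 1
  have hsplit : (t / (2 * π)) ^ ((3 : ℝ) / 2) =
      (t / (2 * π)) ^ ((3 : ℝ) / 2 - 1) * (t / (2 * π)) := by
    rw [Real.rpow_sub_one hs.ne']
    field_simp
  have hp : 0 < (t / (2 * π)) ^ ((3 : ℝ) / 2 - 1) := by positivity
  simp only [id]
  rw [hsplit]
  generalize (t / (2 * π)) ^ ((3 : ℝ) / 2 - 1) = p at hp
  field_simp
  ring

theorem mul_chi_sq_eq {k : ℕ} (hk : k ≠ 0) (t : ℝ) :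
    (k : ℂ) ^ (I * t) * chi (1 / 2 + I * t) ^ 2 =
      cexp (I * ((Real.log k + 2 * Real.log π : ℝ) * t)) *
        (Gamma (1 / 4 - I * (t / 2)) / Gamma (1 / 4 + I * (t / 2))) ^ 2 := by
  have hk' : (k : ℂ) ≠ 0 := by exact_mod_cast hk
  have hπ : (π : ℂ) ≠ 0 := by exact_mod_cast pi_ne_zero
  rw [chi_critical_line, mul_pow, ← mul_assoc, cpow_def_of_ne_zero hk', cpow_def_of_ne_zero hπ,
    ← Complex.exp_nat_mul, ← Complex.exp_add, ofReal_add, ofReal_mul, ofReal_log pi_pos.le,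
    natCast_log]
  congr 2
  push_cast
  ring

theorem norm_integral_cutoff_le {ρ : ℝ → ℝ} (hρ_smooth : ContDiffOn ℝ (⊤ : ℕ∞) ρ (Set.Ioi 0))
    (hρ_nonneg : ∀ u : ℝ, 0 < u → 0 ≤ ρ u)
    (hρ_fe : ∀ u : ℝ, 0 < u → ρ u + ρ (1 / u) = 1)
    {M : ℝ} (hM : ∀ u : ℝ, 0 < u → |u * deriv ρ u| ≤ M)
    {T : ℝ} (hT : 0 < T) (hlog : 40 ≤ Real.log T) {k : ℕ} (hk : k ≠ 0)
    (hkT : (k : ℝ) ≤ (T / π) ^ ((3 : ℝ) / 2)) :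
    ‖∫ t in T..(2 * T), ((ρ (k / ((1 / 2) * (t / (2 * π)) ^ ((3:ℝ)/2))) : ℝ) : ℂ) *
      (k : ℂ) ^ (I * t) * chi (1 / 2 + I * t) ^ (2 : ℕ)‖ ≤ 3 + 3 / 2 * M := by
  have hk0 : (0 : ℝ) < k := by exact_mod_cast Nat.pos_of_ne_zero hk
  have hT2 : T ≤ 2 * T := by linarith
  have hpos : ∀ t ∈ Set.Icc T (2 * T), 0 < t := fun t ht => hT.trans_le ht.1
  set L : ℝ := Real.log k + 2 * Real.log π with hL
  set w : ℝ → ℝ := fun t => ρ (k / ((1 / 2) * (t / (2 * π)) ^ ((3:ℝ)/2))) with hw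
  have hudpos : ∀ t ∈ Set.Icc T (2 * T),
      0 < (k : ℝ) / ((1 / 2) * (t / (2 * π)) ^ ((3:ℝ)/2)) := fun t ht => by
    have := hpos t ht
    positivity
  have hwd : ∀ t ∈ Set.Icc T (2 * T), HasDerivAt w _ t := fun t ht =>
    hasDerivAt_cutoff hρ_smooth hk0 (hpos t ht)
  have hw1 : ∀ t ∈ Set.Icc T (2 * T), |w t| ≤ 1 := fun t ht =>
    abs_cutoff_le_one hρ_nonneg hρ_fe (hudpos t ht)
  have hwc : ContinuousOn w (Set.Icc T (2 * T)) := fun t ht =>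
    (hwd t ht).continuousAt.continuousWithinAt
  have huc : ContinuousOn (fun t : ℝ => (k : ℝ) / ((1 / 2) * (t / (2 * π)) ^ ((3:ℝ)/2)))
      (Set.Icc T (2 * T)) := by
    refine continuousOn_const.div (continuousOn_const.mul
      ((continuousOn_id.div_const _).rpow_const fun t ht => Or.inr (by norm_num))) fun t ht => ?_
    have := hpos t ht
    positivity
  have hdc : ContinuousOn (deriv ρ) (Set.Ioi 0) :=
    hρ_smooth.continuousOn_deriv_of_isOpen isOpen_Ioi (by exact_mod_cast le_top)
  have hbound : ∀ N : ℕ, 1 ≤ N → 2 * T ≤ N →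
      ‖∫ t in T..(2 * T), (w t : ℂ) * cexp (I * gammaPhase L N t)‖ ≤ 3 + 3 / 2 * M := by
    intro N hN1 hN
    have h := norm_integral_mul_exp_le hT2 (M := 3 / 2 * M / T) hwd
      ((hdc.comp huc hudpos).mul ((continuousOn_const.mul huc).div continuousOn_id
        fun t ht => (hpos t ht).ne'))
      (fun t _ => hasDerivAt_gammaPhase L N t) (fun t _ => hasDerivAt_gammaPhaseDeriv L N t)
      (continuous_gammaPhaseDeriv₂ N).continuousOn
      (fun t ht => gammaPhaseDeriv₂_nonpos N (hpos t ht).le)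
      (fun t ht => ?_) hw1 (fun t ht => ?_)
    · refine h.trans (le_of_eq ?_)
      field_simp
      ring
    · have h1 := gammaPhaseDeriv_le L (hpos t ht) hN1 (ht.2.trans hN)
      have h2 := Real.log_le_log hT ht.1
      have h3 := Real.log_le_log hk0 hkT
      rw [Real.log_rpow (by positivity), Real.log_div hT.ne' pi_ne_zero] at h3
      have h4 := Real.log_le_sub_one_of_pos pi_pos
      linarith [pi_le_four]
    · have ht0 := hpos t ht
      have h1 := hM _ (hudpos t ht)
      generalize (k : ℝ) / ((1 / 2) * (t / (2 * π)) ^ ((3:ℝ)/2)) = u at h1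
      have hM0 : 0 ≤ M := (abs_nonneg _).trans h1
      rw [show deriv ρ u * (-(3 / 2) * u / t) = -(3 / 2 * (u * deriv ρ u) / t) by ring, abs_neg,
        abs_div, abs_mul, abs_of_pos ht0, abs_of_pos (by norm_num : (0 : ℝ) < 3 / 2)]
      have := ht.1
      gcongr
  have hlim : Tendsto (fun N : ℕ => ∫ t in T..(2 * T), (w t : ℂ) * cexp (I * gammaPhase L N t))
      atTop (nhds (∫ t in T..(2 * T), (w t : ℂ) * (k : ℂ) ^ (I * t) *
        chi (1 / 2 + I * t) ^ (2 : ℕ))) := by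
    refine intervalIntegral.tendsto_integral_filter_of_dominated_convergence (fun _ => 1)
      (Eventually.of_forall fun N => ?_) (Eventually.of_forall fun N => ?_)
      intervalIntegrable_const ?_
    · have hg : Continuous (gammaPhase L N) := continuous_iff_continuousAt.2 fun t =>
        (hasDerivAt_gammaPhase L N t).continuousAt
      rw [Set.uIoc_of_le hT2]
      refine ContinuousOn.aestronglyMeasurable ?_ measurableSet_Ioc
      have := hwc.mono Set.Ioc_subset_Icc_self
      fun_prop
    · refine Eventually.of_forall fun t ht => ?_
      rw [Set.uIoc_of_le hT2] at ht
      rw [norm_mul, mul_comm I, norm_exp_ofReal_mul_I, mul_one, Complex.norm_real]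
      exact hw1 t (Set.Ioc_subset_Icc_self ht)
    · refine Eventually.of_forall fun t _ => ?_
      rw [mul_assoc, mul_chi_sq_eq hk]
      exact (tendsto_exp_gammaPhase L t).const_mul _
  refine le_of_tendsto hlim.norm ?_
  filter_upwards [eventually_ge_atTop 1, eventually_ge_atTop ⌈2 * T⌉₊] with N h1 h2
  exact hbound N h1 (Nat.ceil_le.1 h2)

theorem integral_cutoff_eq_zero {ρ : ℝ → ℝ} (hρ_supp : ∀ u : ℝ, 2 ≤ u → ρ u = 0)
    {T : ℝ} (hT : 0 < T) {k : ℕ} (hkT : (T / π) ^ ((3 : ℝ) / 2) ≤ k) :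
    ∫ t in T..(2 * T), ((ρ (k / ((1 / 2) * (t / (2 * π)) ^ ((3:ℝ)/2))) : ℝ) : ℂ) *
      (k : ℂ) ^ (I * t) * chi (1 / 2 + I * t) ^ (2 : ℕ) = 0 := by
  refine intervalIntegral.integral_zero_ae (Eventually.of_forall fun t ht => ?_)
  rw [Set.uIoc_of_le (by linarith)] at ht
  have ht0 : 0 < t := hT.trans ht.1
  have h1 : (t / (2 * π)) ^ ((3:ℝ)/2) ≤ (T / π) ^ ((3 : ℝ) / 2) := by
    refine Real.rpow_le_rpow (by positivity) ?_ (by norm_num)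
    rw [div_le_div_iff₀ (by positivity) pi_pos]
    nlinarith [ht.2, pi_pos]
  rw [hρ_supp _ (by rw [le_div_iff₀ (by positivity)]; linarith)]
  simp

theorem stmt15 (ρ : ℝ → ℝ) (hρ_smooth : ContDiffOn ℝ (⊤ : ℕ∞) ρ (Set.Ioi 0))
    (hρ_nonneg : ∀ u : ℝ, 0 < u → 0 ≤ ρ u)
    (hρ_fe : ∀ u : ℝ, 0 < u → ρ u + ρ (1 / u) = 1)
    (hρ_supp : ∀ u : ℝ, 2 ≤ u → ρ u = 0) :
    (fun T : ℝ =>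
        ∑' k : ℕ, ((d3 k : ℝ) * (k : ℝ) ^ (-(1:ℝ)/2) : ℝ) *
          ∫ t in T..(2 * T), ((ρ (k / ((1 / 2) * (t / (2 * π)) ^ ((3:ℝ)/2))) : ℝ) : ℂ) *
            (k : ℂ) ^ (I * t) * chi (1 / 2 + I * t) ^ (2 : ℕ))
      =O[atTop] fun T : ℝ => T ^ ((3:ℝ)/4) * (Real.log T) ^ 2 := by
  obtain ⟨M, hM0, hM⟩ := exists_abs_mul_deriv_le hρ_smooth hρ_fe hρ_supp
  refine Asymptotics.IsBigO.of_bound ((3 + 3 / 2 * M) * (2 * 3 ^ 2)) ?_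
  filter_upwards [Real.tendsto_log_atTop.eventually_ge_atTop 40, eventually_ge_atTop 4]
    with T hlog hT4
  have hT : 0 < T := by linarith
  set x : ℝ := (T / π) ^ ((3 : ℝ) / 2) with hx
  have hTπ : 1 ≤ T / π := by rw [le_div_iff₀ pi_pos]; linarith [pi_le_four]
  have hx1 : 1 ≤ x := Real.one_le_rpow hTπ (by norm_num)
  have hx0 : 0 ≤ x := by linarith
  have hxT : x ≤ T ^ ((3 : ℝ) / 2) := Real.rpow_le_rpow (by positivity)
    (div_le_self hT.le (by linarith [pi_gt_three])) (by norm_num)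
  have hxhalf : x ^ ((1 : ℝ) / 2) ≤ T ^ ((3 : ℝ) / 4) := by
    refine (Real.rpow_le_rpow hx0 hxT (by norm_num)).trans (le_of_eq ?_)
    rw [← Real.rpow_mul hT.le]
    norm_num
  have hxlog : 1 + Real.log x ≤ 3 * Real.log T := by
    have := Real.log_le_log (by linarith) hxT
    rw [Real.log_rpow hT] at this
    linarith
  rw [tsum_eq_sum (s := range (⌊x⌋₊ + 1)) fun k hk => by
    rw [integral_cutoff_eq_zero hρ_supp hT, mul_zero]
    rw [mem_range, not_lt] at hk
    exact (Nat.lt_of_floor_lt hk).le]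
  calc _ ≤ ∑ k ∈ range (⌊x⌋₊ + 1),
        ((d3 k : ℝ) * (k : ℝ) ^ (-(1 : ℝ) / 2)) * (3 + 3 / 2 * M) := by
        refine (norm_sum_le _ _).trans (sum_le_sum fun k hk => ?_)
        rcases eq_or_ne k 0 with rfl | hk0
        · simp [d3_zero]
        rw [norm_mul, Complex.norm_real, Real.norm_of_nonneg (by positivity)]
        refine mul_le_mul_of_nonneg_left ?_ (by positivity)
        exact norm_integral_cutoff_le hρ_smooth hρ_nonneg hρ_fe hM hT hlog hk0
          ((Nat.le_floor_iff hx0).1 (Nat.lt_succ_iff.1 (mem_range.1 hk)))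
    _ ≤ (2 * x ^ ((1 : ℝ) / 2) * (1 + Real.log x) ^ 2) * (3 + 3 / 2 * M) := by
        rw [← sum_mul]
        exact mul_le_mul_of_nonneg_right (sum_d3_rpow_le hx1) (by positivity)
    _ ≤ (2 * T ^ ((3 : ℝ) / 4) * (3 * Real.log T) ^ 2) * (3 + 3 / 2 * M) := by
        have := Real.log_nonneg hx1
        gcongr
    _ = _ := by
        rw [Real.norm_of_nonneg (by positivity)]
        ring
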